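/- Let f(z) = Σ_{n=0}^∞ a_n z^n belong to the class B and let λ = (221 − 43√17)/64. Then for every z in the unit disk with |z| = r ≤ (√17 − 3)/4, one has |f(z)| + |f′(z)| r + B₂(f,r) + A(f₀,r) + λ·(S_r/(π − S_r)) ≤ 1, where S_r/(π − S_r) = (S_r/π)/(1 − S_r/π) and S_r/π = Σ_{n=1}^∞ n |a_n|² r^{2n}. Moreover, neither the radius (√17 − 3)/4 nor the constant λ = (221 − 43√17)/64 can be improved: for any λ′ > λ there exists f ∈ B (of the form f*_a(z) = (a+z)/(1+az) with a close to 1) for which the corresponding sum at r = (√17 − 3)/4 exceeds 1. -/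

import Mathlib

/-- Membership in the class `B` of analytic self-maps of the unit disk,
together with its Taylor coefficient sequence `a`. -/
def InClassB (f : ℂ → ℂ) (a : ℕ → ℂ) : Prop :=
  (∀ z : ℂ, ‖z‖ < 1 → HasSum (fun n => a n * z ^ n) (f z)) ∧
  (∀ z : ℂ, ‖z‖ < 1 → ‖f z‖ ≤ 1)

/-- `S_r/π = Σ_{n=1}^∞ n |a_n|² r^{2n}`. -/
noncomputable def SrOverPi (a : ℕ → ℂ) (r : ℝ) : ℝ :=
  ∑' n : ℕ, ((n : ℝ) + 1) * ‖a (n + 1)‖ ^ 2 * r ^ (2 * (n + 1))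

/-- The quantity `𝒢_{2,f}(r) = |f(z)| + |f′(z)|r + B₂(f,r) + A(f₀,r) + λ S_r/(π−S_r)`,
where `S_r/(π−S_r) = (S_r/π)/(1−S_r/π)`. -/
noncomputable def Gexpr2 (f : ℂ → ℂ) (a : ℕ → ℂ) (z : ℂ) (r lam : ℝ) : ℝ :=
  ‖f z‖ + ‖deriv f z‖ * r + (∑' n : ℕ, ‖a (n + 2)‖ * r ^ (n + 2))
    + (1 / (1 + ‖a 0‖) + r / (1 - r)) * (∑' n : ℕ, ‖a (n + 1)‖ ^ 2 * r ^ (2 * (n + 1)))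
    + lam * (SrOverPi a r / (1 - SrOverPi a r))


open Filter Topology

theorem circleAverage_zpow (m : ℤ) :
    Real.circleAverage (fun z : ℂ => z ^ m) 0 1 = if m = 0 then 1 else 0 := by
  split_ifs with h
  · subst h
    simpa using Real.circleAverage_const (1 : ℂ) 0 1
  · rw [Real.circleAverage_eq_circleIntegral one_ne_zero]
    have : (∮ z in C((0 : ℂ), 1), (z - 0)⁻¹ • z ^ m) = ∮ z in C((0 : ℂ), 1), (z - 0) ^ (m - 1) := by
      refine circleIntegral.integral_congr zero_le_one fun z hz => ?_
      have hz0 : z ≠ 0 := by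
        rintro rfl
        simp at hz
      simp only [sub_zero, smul_eq_mul]
      rw [zpow_sub_one₀ hz0, mul_comm]
    rw [this, circleIntegral.integral_sub_zpow_of_ne (by omega), smul_zero]

theorem circleAverage_mul_zpow_of_hasSum {c : ℕ → ℂ} {g : ℂ → ℂ} (hc : Summable fun n => ‖c n‖)
    (hg : ∀ z : ℂ, ‖z‖ = 1 → HasSum (fun n => c n * z ^ n) (g z)) (k N : ℕ) :
    Real.circleAverage (fun z => g z * z ^ k * (z ^ N)⁻¹) 0 1 =
      if k ≤ N then c (N - k) else 0 := by
  have hterm (n : ℕ) : Real.circleAverage (fun z : ℂ => c n * z ^ n * z ^ k * (z ^ N)⁻¹) 0 1 =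
      if n + k = N then c n else 0 := by
    have h1 : Real.circleAverage (fun z : ℂ => c n * z ^ n * z ^ k * (z ^ N)⁻¹) 0 1 =
        Real.circleAverage (fun z : ℂ => c n • z ^ ((n : ℤ) + k - N)) 0 1 := by
      refine Real.circleAverage_congr_sphere fun z hz => ?_
      have hz0 : z ≠ 0 := by
        rintro rfl
        simp at hz
      simp only [smul_eq_mul]
      rw [zpow_sub₀ hz0, zpow_add₀ hz0]
      simp [div_eq_mul_inv, mul_assoc]
    rw [h1, Real.circleAverage_fun_smul, circleAverage_zpow]
    have : ((n : ℤ) + k - N = 0) ↔ n + k = N := by omega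
    simp [this]
  have hcont (n : ℕ) : Continuous fun θ : ℝ => c n * circleMap 0 1 θ ^ n * circleMap 0 1 θ ^ k *
      (circleMap 0 1 θ ^ N)⁻¹ := by
    have : Continuous (circleMap 0 1) := continuous_circleMap 0 1
    exact ((continuous_const.mul (this.pow n)).mul (this.pow k)).mul
      ((this.pow N).inv₀ fun θ => pow_ne_zero _ (circleMap_ne_center one_ne_zero))
  have hsum := intervalIntegral.hasSum_integral_of_dominated_convergence (μ := MeasureTheory.volume)
    (a := 0) (b := 2 * Real.pi)
    (F := fun n θ => c n * circleMap 0 1 θ ^ n * circleMap 0 1 θ ^ k * (circleMap 0 1 θ ^ N)⁻¹)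
    (f := fun θ => g (circleMap 0 1 θ) * circleMap 0 1 θ ^ k * (circleMap 0 1 θ ^ N)⁻¹)
    (fun n _ => ‖c n‖) (fun n => (hcont n).aestronglyMeasurable)
    (fun n => Eventually.of_forall fun θ _ => by simp)
    (Eventually.of_forall fun θ _ => hc)
    intervalIntegrable_const
    (Eventually.of_forall fun θ _ => ((hg _ (by simp)).mul_right _).mul_right _)
  have hsum2 := hsum.const_smul ((2 * Real.pi)⁻¹)
  have h2 := hsum2.tsum_eq
  rw [Real.circleAverage_def, ← h2]
  have h3 : ∀ n, (2 * Real.pi)⁻¹ • ∫ θ in (0 : ℝ)..2 * Real.pi,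
      c n * circleMap 0 1 θ ^ n * circleMap 0 1 θ ^ k * (circleMap 0 1 θ ^ N)⁻¹ =
      if n + k = N then c n else 0 := fun n => hterm n
  simp_rw [h3]
  split_ifs with h
  · rw [tsum_eq_single (N - k)]
    · rw [if_pos (by omega)]
    · intro n hn
      rw [if_neg (by omega)]
  · convert tsum_zero with n
    rw [if_neg (by omega)]

theorem circleAverage_mul_eval {c : ℕ → ℂ} {g : ℂ → ℂ} (hc : Summable fun n => ‖c n‖)
    (hgc : ContinuousOn g (Metric.sphere 0 1))
    (hg : ∀ z : ℂ, ‖z‖ = 1 → HasSum (fun n => c n * z ^ n) (g z)) (N : ℕ) (q : Polynomial ℂ) :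
    Real.circleAverage (fun z => g z * q.eval z * (z ^ N)⁻¹) 0 1 =
      PowerSeries.coeff N (PowerSeries.mk c * (q : PowerSeries ℂ)) := by
  have hint (p : Polynomial ℂ) : CircleIntegrable (fun z => g z * p.eval z * (z ^ N)⁻¹) 0 1 := by
    refine ContinuousOn.circleIntegrable zero_le_one ?_
    refine (hgc.mul p.continuous.continuousOn).mul (ContinuousOn.inv₀ (by fun_prop) ?_)
    intro z hz
    refine pow_ne_zero _ ?_
    rintro rfl
    simp at hz
  induction q using Polynomial.induction_on' with
  | add p q hp hq =>
    rw [Polynomial.coe_add, mul_add, map_add, ← hp, ← hq,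
      ← Real.circleAverage_fun_add (hint p) (hint q)]
    congr 1
    ext z
    rw [Polynomial.eval_add]
    ring
  | monomial k b =>
    have : (fun z => g z * (Polynomial.monomial k b).eval z * (z ^ N)⁻¹) =
        fun z => b • (g z * z ^ k * (z ^ N)⁻¹) := by
      ext z
      simp only [Polynomial.eval_monomial, smul_eq_mul]
      ring
    rw [this, Real.circleAverage_fun_smul, circleAverage_mul_zpow_of_hasSum hc hg]
    rw [← Polynomial.C_mul_X_pow_eq_monomial]
    simp only [Polynomial.coe_mul, Polynomial.coe_C, Polynomial.coe_pow, Polynomial.coe_X]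
    rw [mul_left_comm, PowerSeries.coeff_C_mul, PowerSeries.coeff_mul_X_pow']
    simp

namespace InClassB

variable {f : ℂ → ℂ} {a : ℕ → ℂ}

theorem summable_norm (h : InClassB f a) {r : ℝ} (hr0 : 0 ≤ r) (hr : r < 1) :
    Summable fun n => ‖a n‖ * r ^ n := by
  have hs := (h.1 (r : ℂ) (by simpa [abs_of_nonneg hr0] using hr)).summable.norm
  simpa [abs_of_nonneg hr0] using hs

theorem differentiableOn (h : InClassB f a) : DifferentiableOn ℂ f (Metric.ball 0 1) := by
  intro z hz
  have hz1 : ‖z‖ < 1 := by simpa using hz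
  obtain ⟨ρ, hzρ, hρ⟩ := exists_between hz1
  have hρ0 : 0 ≤ ρ := (norm_nonneg z).trans hzρ.le
  have hd : DifferentiableOn ℂ (fun w : ℂ => ∑' n, a n * w ^ n) (Metric.ball 0 ρ) := by
    refine Complex.differentiableOn_tsum_of_summable_norm (h.summable_norm hρ0 hρ)
      (fun n => by fun_prop) Metric.isOpen_ball fun n w hw => ?_
    rw [norm_mul, norm_pow]
    have : ‖w‖ < ρ := by simpa using hw
    gcongr
  have hm : Metric.ball (0 : ℂ) ρ ∈ 𝓝 z := Metric.isOpen_ball.mem_nhds (by simpa using hzρ)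
  refine ((hd.differentiableAt hm).congr_of_eventuallyEq ?_).differentiableWithinAt
  filter_upwards [hm] with w hw
  have hw1 : ‖w‖ < ρ := by simpa using hw
  exact (h.1 w (hw1.trans hρ)).tsum_eq.symm

theorem coeff_zero (h : InClassB f a) : f 0 = a 0 := by
  have h1 := h.1 0 (by simp)
  have h2 := hasSum_single (f := fun n => a n * (0 : ℂ) ^ n) 0 fun n hn => by simp [hn]
  simpa using h1.unique h2

/-- Multiplication by a self-map of the disk does not increase the `H²` norm; applied to `f p · p`,
this bounds the coefficients of `f p²`. -/
theorem norm_coeff_mul_sq_le (h : InClassB f a) (p : Polynomial ℂ) (N : ℕ) :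
    ‖PowerSeries.coeff N (PowerSeries.mk a * ((p ^ 2 : Polynomial ℂ) : PowerSeries ℂ))‖ ≤
      ∑ i ∈ p.support, ‖p.coeff i‖ ^ 2 := by
  have key (ρ : ℝ) (hρ0 : 0 < ρ) (hρ : ρ < 1) :
      ‖PowerSeries.coeff N (PowerSeries.mk (fun n => a n * (ρ : ℂ) ^ n) *
        ((p ^ 2 : Polynomial ℂ) : PowerSeries ℂ))‖ ≤ ∑ i ∈ p.support, ‖p.coeff i‖ ^ 2 := by
    have hin (z : ℂ) (hz : ‖z‖ = 1) : ‖(ρ : ℂ) * z‖ < 1 := by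
      simpa [hz, abs_of_pos hρ0] using hρ
    have hgc : ContinuousOn (fun z => f (ρ * z)) (Metric.sphere 0 1) := by
      refine h.differentiableOn.continuousOn.comp (by fun_prop) fun z hz => ?_
      simpa using hin z (by simpa using hz)
    rw [← circleAverage_mul_eval (g := fun z => f (ρ * z)) ?_ hgc ?_,
      Polynomial.sum_sq_norm_coeff_eq_circleAverage, Real.circleAverage_def, Real.circleAverage_def,
      norm_smul, Real.norm_of_nonneg (by positivity), smul_eq_mul]
    · refine mul_le_mul_of_nonneg_left ?_ (by positivity)
      refine intervalIntegral.norm_integral_le_of_norm_le (by positivity) ?_ ?_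
      · refine Eventually.of_forall fun θ _ => ?_
        have := h.2 _ (hin (circleMap 0 1 θ) (by simp))
        simp only [Polynomial.eval_pow, norm_mul, norm_inv, norm_pow, norm_circleMap_zero, abs_one,
          one_pow, inv_one, mul_one]
        exact mul_le_of_le_one_left (by positivity) this
      · refine Continuous.intervalIntegrable ?_ _ _
        exact ((p.continuous.comp (continuous_circleMap 0 1)).norm).pow 2
    · simpa [abs_of_pos hρ0] using h.summable_norm hρ0.le hρ
    · intro z hz
      simpa [mul_pow, mul_assoc] using h.1 _ (hin z hz)
  have hcont : Continuous fun ρ : ℝ => ‖PowerSeries.coeff N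
      (PowerSeries.mk (fun n => a n * (ρ : ℂ) ^ n) * ((p ^ 2 : Polynomial ℂ) : PowerSeries ℂ))‖ := by
    simp only [PowerSeries.coeff_mul, PowerSeries.coeff_mk]
    fun_prop
  have ht : Tendsto (fun ρ : ℝ => ‖PowerSeries.coeff N
      (PowerSeries.mk (fun n => a n * (ρ : ℂ) ^ n) * ((p ^ 2 : Polynomial ℂ) : PowerSeries ℂ))‖) (𝓝[<] 1)
      (𝓝 ‖PowerSeries.coeff N (PowerSeries.mk a * ((p ^ 2 : Polynomial ℂ) : PowerSeries ℂ))‖) := by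
    have := (hcont.tendsto 1).mono_left (nhdsWithin_le_nhds (s := Set.Iio 1))
    simpa using this
  refine le_of_tendsto ht ?_
  filter_upwards [Ioo_mem_nhdsLT (zero_lt_one (α := ℝ))] with ρ hρ
  exact key ρ hρ.1 hρ.2

theorem norm_quadratic_coeff_le (h : InClassB f a) {m N : ℕ} (hm : m ≤ N) (b : ℕ → ℂ) :
    ‖a N + 2 * ∑ j ∈ Finset.range m, b j * a j + ∑ i ∈ Finset.range m, ∑ j ∈ Finset.range m,
      b i * b j * (if N ≤ i + j then a (i + j - N) else 0)‖ ≤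
      1 + ∑ j ∈ Finset.range m, ‖b j‖ ^ 2 := by
  set q : Polynomial ℂ := ∑ j ∈ Finset.range m, Polynomial.C (b j) * Polynomial.X ^ (N - j)
    with hq
  have hcoe : (q : PowerSeries ℂ) =
      ∑ j ∈ Finset.range m, PowerSeries.C (b j) * PowerSeries.X ^ (N - j) := by
    rw [hq, ← Polynomial.coeToPowerSeries.ringHom_apply, map_sum]
    simp
  have hcoeff (k : ℕ) : q.coeff k = ∑ j ∈ Finset.range m, if k = N - j then b j else 0 := by
    simp [hq, Polynomial.finsetSum_coeff, Polynomial.coeff_X_pow]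
  have hlin : PowerSeries.coeff N (PowerSeries.mk a * (q : PowerSeries ℂ)) =
      ∑ j ∈ Finset.range m, b j * a j := by
    rw [hcoe, Finset.mul_sum, map_sum]
    refine Finset.sum_congr rfl fun j hj => ?_
    have := Finset.mem_range.1 hj
    rw [mul_left_comm, PowerSeries.coeff_C_mul, PowerSeries.coeff_mul_X_pow', if_pos (by omega),
      PowerSeries.coeff_mk, Nat.sub_sub_self (by omega)]
  have hquad : PowerSeries.coeff N (PowerSeries.mk a * (q : PowerSeries ℂ) ^ 2) =
      ∑ i ∈ Finset.range m, ∑ j ∈ Finset.range m,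
        b i * b j * (if N ≤ i + j then a (i + j - N) else 0) := by
    rw [hcoe, sq, Finset.sum_mul_sum, Finset.mul_sum, map_sum]
    refine Finset.sum_congr rfl fun i hi => ?_
    rw [Finset.mul_sum, map_sum]
    refine Finset.sum_congr rfl fun j hj => ?_
    have h1 := Finset.mem_range.1 hi
    have h2 := Finset.mem_range.1 hj
    have h3 : PowerSeries.mk a * (PowerSeries.C (b i) * PowerSeries.X ^ (N - i) *
        (PowerSeries.C (b j) * PowerSeries.X ^ (N - j))) =
        PowerSeries.C (b i * b j) * (PowerSeries.mk a * PowerSeries.X ^ (N - i + (N - j))) := by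
      rw [map_mul, pow_add]
      ring
    rw [h3, PowerSeries.coeff_C_mul, PowerSeries.coeff_mul_X_pow', PowerSeries.coeff_mk]
    by_cases h4 : N ≤ i + j
    · rw [if_pos (by omega), if_pos h4]
      congr 2
      omega
    · rw [if_neg (by omega), if_neg h4]
  have hmain := h.norm_coeff_mul_sq_le (1 + q) N
  have hexp : PowerSeries.mk a * (((1 + q) ^ 2 : Polynomial ℂ) : PowerSeries ℂ) =
      PowerSeries.mk a + PowerSeries.C 2 * (PowerSeries.mk a * (q : PowerSeries ℂ)) +
        PowerSeries.mk a * (q : PowerSeries ℂ) ^ 2 := by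
    rw [Polynomial.coe_pow, Polynomial.coe_add, Polynomial.coe_one, map_ofNat]
    ring
  rw [hexp, map_add, map_add, PowerSeries.coeff_C_mul, hlin, hquad, PowerSeries.coeff_mk] at hmain
  refine hmain.trans ?_
  have hc0 : (1 + q).coeff 0 = 1 := by
    rw [Polynomial.coeff_add, hcoeff, Finset.sum_eq_zero]
    · simp
    · intro j hj
      have := Finset.mem_range.1 hj
      rw [if_neg (by omega)]
  have hcj (j : ℕ) (hj : j ∈ Finset.range m) : (1 + q).coeff (N - j) = b j := by
    have hj1 := Finset.mem_range.1 hj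
    rw [Polynomial.coeff_add, hcoeff, Polynomial.coeff_one, if_neg (by omega), zero_add,
      Finset.sum_eq_single_of_mem j hj, if_pos rfl]
    intro i hi hij
    have := Finset.mem_range.1 hi
    rw [if_neg (by omega)]
  have hsub : (1 + q).support ⊆ insert 0 ((Finset.range m).image (N - ·)) := by
    intro k hk
    by_contra hcon
    simp only [Finset.mem_insert, Finset.mem_image, not_or, not_exists, not_and] at hcon
    refine Polynomial.mem_support_iff.1 hk ?_
    rw [Polynomial.coeff_add, hcoeff, Polynomial.coeff_one, if_neg hcon.1, zero_add]
    refine Finset.sum_eq_zero fun j hj => ?_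
    rw [if_neg fun h => hcon.2 j hj h.symm]
  refine (Finset.sum_le_sum_of_subset_of_nonneg hsub fun _ _ _ => by positivity).trans ?_
  rw [Finset.sum_insert, Finset.sum_image, hc0]
  · refine le_of_eq ?_
    rw [norm_one, one_pow]
    congr 1
    exact Finset.sum_congr rfl fun j hj => by rw [hcj j hj]
  · intro i hi j hj hij
    have h1 := Finset.mem_range.1 hi
    have h2 := Finset.mem_range.1 hj
    dsimp only at hij
    omega
  · simp only [Finset.mem_image, Finset.mem_range, not_exists, not_and]
    intro j hj
    omega

end InClassB

theorem exists_norm_one_eq_norm_mul (w : ℂ) : ∃ u : ℂ, ‖u‖ = 1 ∧ w = ‖w‖ * u := by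
  by_cases hw : w = 0
  · exact ⟨1, by simp, by simp [hw]⟩
  · refine ⟨w / ‖w‖, ?_, ?_⟩
    · simp [hw]
    · rw [mul_div_cancel₀ _ (by simpa using hw)]

namespace InClassB

variable {f : ℂ → ℂ} {a : ℕ → ℂ}

open ComplexConjugate

theorem norm_coeff_odd_le (h : InClassB f a) (n : ℕ) :
    ‖a (2 * n + 1)‖ ≤ 1 - ∑ k ∈ Finset.range (n + 1), ‖a k‖ ^ 2 := by
  obtain ⟨u, hu, hau⟩ := exists_norm_one_eq_norm_mul (a (2 * n + 1))
  have hq := h.norm_quadratic_coeff_le (m := n + 1) (N := 2 * n + 1) (by omega)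
    fun j => u * conj (a j)
  have hz : ∑ i ∈ Finset.range (n + 1), ∑ j ∈ Finset.range (n + 1),
      (u * conj (a i)) * (u * conj (a j)) *
        (if 2 * n + 1 ≤ i + j then a (i + j - (2 * n + 1)) else 0) = 0 := by
    refine Finset.sum_eq_zero fun i hi => Finset.sum_eq_zero fun j hj => ?_
    have h1 := Finset.mem_range.1 hi
    have h2 := Finset.mem_range.1 hj
    rw [if_neg (by omega), mul_zero]
  have hs : ∑ j ∈ Finset.range (n + 1), u * conj (a j) * a j =
      u * ((∑ k ∈ Finset.range (n + 1), ‖a k‖ ^ 2 : ℝ) : ℂ) := by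
    push_cast
    rw [Finset.mul_sum]
    refine Finset.sum_congr rfl fun j _ => ?_
    rw [mul_assoc, Complex.conj_mul']
  simp only [hz, hs, add_zero, norm_mul, hu, one_mul, RCLike.norm_conj] at hq
  set S := ∑ k ∈ Finset.range (n + 1), ‖a k‖ ^ 2 with hS
  have hS0 : 0 ≤ S := Finset.sum_nonneg fun _ _ => by positivity
  have he : a (2 * n + 1) + 2 * (u * (S : ℂ)) = ((‖a (2 * n + 1)‖ + 2 * S : ℝ) : ℂ) * u := by
    conv_lhs => rw [hau]
    push_cast
    ring
  rw [he, norm_mul, hu, mul_one, Complex.norm_real, Real.norm_of_nonneg (by positivity)] at hq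
  linarith

theorem norm_coeff_even_le (h : InClassB f a) {n : ℕ} (hn : 1 ≤ n) :
    ‖a (2 * n)‖ ≤ 1 - ∑ k ∈ Finset.range n, ‖a k‖ ^ 2 - ‖a n‖ ^ 2 / (1 + ‖a 0‖) := by
  obtain ⟨u, hu, hau⟩ := exists_norm_one_eq_norm_mul (a (2 * n))
  set t : ℝ := 1 / (1 + ‖a 0‖) with ht
  have ht0 : 0 ≤ t := by positivity
  set b : ℕ → ℂ := fun j => (if j = n then (t : ℂ) else 1) * (u * conj (a j)) with hb
  have hbn : b n = t * (u * conj (a n)) := by simp [hb]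
  have hbj {j : ℕ} (hj : j ∈ Finset.range n) : b j = u * conj (a j) := by
    have := (Finset.mem_range.1 hj).ne
    simp [hb, this]
  have hq := h.norm_quadratic_coeff_le (m := n + 1) (N := 2 * n) (by omega) b
  have hz : ∑ i ∈ Finset.range (n + 1), ∑ j ∈ Finset.range (n + 1),
      b i * b j * (if 2 * n ≤ i + j then a (i + j - 2 * n) else 0) = b n * b n * a 0 := by
    rw [Finset.sum_eq_single_of_mem n (by simp), Finset.sum_eq_single_of_mem n (by simp),
      if_pos (by omega), show n + n - 2 * n = 0 by omega]
    · intro j hj hjn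
      have := Finset.mem_range.1 hj
      rw [if_neg (by omega), mul_zero]
    · intro i hi hin
      refine Finset.sum_eq_zero fun j hj => ?_
      have h1 := Finset.mem_range.1 hi
      have h2 := Finset.mem_range.1 hj
      rw [if_neg (by omega), mul_zero]
  have hs : ∑ j ∈ Finset.range (n + 1), b j * a j =
      u * ((∑ k ∈ Finset.range n, ‖a k‖ ^ 2 + t * ‖a n‖ ^ 2 : ℝ) : ℂ) := by
    rw [Finset.sum_range_succ, hbn]
    push_cast
    rw [mul_add, Finset.mul_sum]
    congr 1
    · refine Finset.sum_congr rfl fun j hj => ?_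
      rw [hbj hj, mul_assoc, Complex.conj_mul']
    · rw [← Complex.conj_mul']
      ring
  have hsq : ∑ j ∈ Finset.range (n + 1), ‖b j‖ ^ 2 =
      ∑ k ∈ Finset.range n, ‖a k‖ ^ 2 + t ^ 2 * ‖a n‖ ^ 2 := by
    rw [Finset.sum_range_succ, hbn]
    congr 1
    · refine Finset.sum_congr rfl fun j hj => ?_
      rw [hbj hj, norm_mul, hu, one_mul, RCLike.norm_conj]
    · rw [norm_mul, norm_mul, hu, one_mul, RCLike.norm_conj, Complex.norm_real,
        Real.norm_of_nonneg ht0, mul_pow]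
  rw [hz, hs, hsq] at hq
  set S := ∑ k ∈ Finset.range n, ‖a k‖ ^ 2 with hS
  have hS0 : 0 ≤ S := Finset.sum_nonneg fun _ _ => by positivity
  have hcross : ‖b n * b n * a 0‖ = t ^ 2 * ‖a n‖ ^ 2 * ‖a 0‖ := by
    rw [hbn]
    simp only [norm_mul, hu, one_mul, RCLike.norm_conj, Complex.norm_real, Real.norm_of_nonneg ht0]
    ring
  have he : a (2 * n) + 2 * (u * ((S + t * ‖a n‖ ^ 2 : ℝ) : ℂ)) =
      ((‖a (2 * n)‖ + 2 * (S + t * ‖a n‖ ^ 2) : ℝ) : ℂ) * u := by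
    conv_lhs => rw [hau]
    push_cast
    ring
  have hn1 := norm_sub_le_norm_add (a (2 * n) + 2 * (u * ((S + t * ‖a n‖ ^ 2 : ℝ) : ℂ)))
    (b n * b n * a 0)
  rw [hcross, he, norm_mul, hu, mul_one, Complex.norm_real,
    Real.norm_of_nonneg (by positivity)] at hn1
  have hopt : t ^ 2 * (1 + ‖a 0‖) = t := by
    rw [ht]
    field_simp
  rw [he] at hq
  have : ‖a n‖ ^ 2 / (1 + ‖a 0‖) = t * ‖a n‖ ^ 2 := by
    rw [ht]
    ring
  rw [this]
  have h3 : t ^ 2 * ‖a n‖ ^ 2 + t ^ 2 * ‖a n‖ ^ 2 * ‖a 0‖ = t * ‖a n‖ ^ 2 := by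
    linear_combination ‖a n‖ ^ 2 * hopt
  linarith

theorem norm_coeff_zero_le (h : InClassB f a) : ‖a 0‖ ≤ 1 := by
  rw [← h.coeff_zero]
  exact h.2 0 (by simp)

theorem norm_coeff_succ_le (h : InClassB f a) (n : ℕ) : ‖a (n + 1)‖ ≤ 1 - ‖a 0‖ ^ 2 := by
  have hmono {k : ℕ} (hk : 1 ≤ k) : ‖a 0‖ ^ 2 ≤ ∑ j ∈ Finset.range k, ‖a j‖ ^ 2 :=
    Finset.single_le_sum (f := fun j => ‖a j‖ ^ 2) (fun _ _ => by positivity)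
      (Finset.mem_range.2 hk)
  obtain ⟨k, hk⟩ := Nat.even_or_odd' (n + 1)
  rcases hk with hk | hk
  · have h1 := h.norm_coeff_even_le (n := k) (by omega)
    have h2 := hmono (k := k) (by omega)
    have h3 : 0 ≤ ‖a k‖ ^ 2 / (1 + ‖a 0‖) := by positivity
    rw [hk]
    linarith
  · have h1 := h.norm_coeff_odd_le k
    have h2 := hmono (k := k + 1) (by omega)
    rw [hk]
    linarith

theorem sum_range_add_sum_range_le (h : InClassB f a) {r : ℝ} (hr0 : 0 ≤ r) (hr : r < 1) (M : ℕ) :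
    ∑ n ∈ Finset.range (2 * M), ‖a (n + 2)‖ * r ^ (n + 2) +
      (1 / (1 + ‖a 0‖) + r / (1 - r)) *
        ∑ n ∈ Finset.range M, ‖a (n + 1)‖ ^ 2 * r ^ (2 * (n + 1)) +
      (1 - ∑ k ∈ Finset.range (M + 1), ‖a k‖ ^ 2) * (r ^ (2 * M + 2) / (1 - r)) ≤
      (1 - ‖a 0‖ ^ 2) * (r ^ 2 / (1 - r)) := by
  induction M with
  | zero => simp
  | succ M ih =>
    refine le_trans ?_ ih
    have he := mul_le_mul_of_nonneg_right (h.norm_coeff_even_le (n := M + 1) (by omega))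
      (pow_nonneg hr0 (2 * M + 2))
    have ho := mul_le_mul_of_nonneg_right (h.norm_coeff_odd_le (M + 1))
      (pow_nonneg hr0 (2 * M + 3))
    rw [show 2 * (M + 1) = 2 * M + 1 + 1 by ring, Finset.sum_range_succ _ (2 * M + 1),
      Finset.sum_range_succ _ (2 * M), Finset.sum_range_succ _ M]
    rw [Finset.sum_range_succ _ (M + 1)] at ho ⊢
    have h1 : 0 < 1 - r := by linarith
    have hid (S α d : ℝ) (hd : d ≠ 0) :
        (1 - S - α / d) * r ^ (2 * M + 2) + (1 - (S + α)) * r ^ (2 * M + 3) +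
          (1 / d + r / (1 - r)) * (α * r ^ (2 * (M + 1))) +
          (1 - (S + α)) * (r ^ (2 * M + 1 + 1 + 2) / (1 - r)) =
        (1 - S) * (r ^ (2 * M + 2) / (1 - r)) := by
      field_simp
      ring
    have hid' := hid (∑ k ∈ Finset.range (M + 1), ‖a k‖ ^ 2) (‖a (M + 1)‖ ^ 2) (1 + ‖a 0‖)
      (by positivity)
    have e1 : 2 * M + 1 + 2 = 2 * M + 3 := rfl
    have e2 : 2 * (M + 1) + 1 = 2 * M + 3 := rfl
    have e3 : 2 * (M + 1) = 2 * M + 2 := rfl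
    rw [e2] at ho
    rw [e3] at he
    rw [e1, mul_add]
    linarith

theorem summable_norm_add_two (h : InClassB f a) {r : ℝ} (hr0 : 0 ≤ r) (hr : r < 1) :
    Summable fun n => ‖a (n + 2)‖ * r ^ (n + 2) :=
  (summable_nat_add_iff 2).2 (h.summable_norm hr0 hr)

theorem summable_norm_sq (h : InClassB f a) {r : ℝ} (hr0 : 0 ≤ r) (hr : r < 1) :
    Summable fun n => ‖a (n + 1)‖ ^ 2 * r ^ (2 * (n + 1)) := by
  have hg : Summable fun n => r ^ (n + 1) :=
    (summable_nat_add_iff 1).2 (summable_geometric_of_lt_one hr0 hr)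
  refine Summable.of_nonneg_of_le (fun n => by positivity) (fun n => ?_) hg
  have h1 : ‖a (n + 1)‖ ≤ 1 :=
    (h.norm_coeff_succ_le n).trans (by linarith [sq_nonneg ‖a 0‖])
  have h2 : r ^ (2 * (n + 1)) ≤ r ^ (n + 1) := pow_le_pow_of_le_one hr0 hr.le (by omega)
  calc ‖a (n + 1)‖ ^ 2 * r ^ (2 * (n + 1)) ≤ 1 * r ^ (n + 1) := by
        gcongr
        exact pow_le_one₀ (norm_nonneg _) h1
    _ = r ^ (n + 1) := one_mul _

theorem tsum_add_tsum_le (h : InClassB f a) {r : ℝ} (hr0 : 0 ≤ r) (hr : r < 1) :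
    ∑' n, ‖a (n + 2)‖ * r ^ (n + 2) +
      (1 / (1 + ‖a 0‖) + r / (1 - r)) * ∑' n, ‖a (n + 1)‖ ^ 2 * r ^ (2 * (n + 1)) ≤
      (1 - ‖a 0‖ ^ 2) * (r ^ 2 / (1 - r)) := by
  have h1 := (h.summable_norm_add_two hr0 hr).hasSum.tendsto_sum_nat
  have h2 := (h.summable_norm_sq hr0 hr).hasSum.tendsto_sum_nat
  have hdouble : Tendsto (fun M : ℕ => 2 * M) atTop atTop :=
    tendsto_id.const_mul_atTop' (by norm_num)
  refine le_of_tendsto' ((h1.comp hdouble).add (h2.const_mul (1 / (1 + ‖a 0‖) + r / (1 - r))))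
    fun M => ?_
  have h3 := h.sum_range_add_sum_range_le hr0 hr M
  have h4 := (norm_nonneg _).trans (h.norm_coeff_odd_le M)
  have h5 : 0 ≤ r ^ (2 * M + 2) / (1 - r) := div_nonneg (by positivity) (by linarith)
  have := mul_nonneg h4 h5
  simp only [Function.comp_apply]
  linarith

theorem srOverPi_nonneg {r : ℝ} (hr0 : 0 ≤ r) : 0 ≤ SrOverPi a r := by
  unfold SrOverPi
  exact tsum_nonneg fun n => by positivity

theorem srOverPi_le (h : InClassB f a) {r : ℝ} (hr0 : 0 ≤ r) (hr : r < 1) :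
    SrOverPi a r ≤ (1 - ‖a 0‖ ^ 2) ^ 2 * (r ^ 2 / (1 - r ^ 2) ^ 2) := by
  have hr2 : ‖r ^ 2‖ < 1 := by
    rw [Real.norm_of_nonneg (by positivity)]
    exact pow_lt_one₀ hr0 hr (by norm_num)
  have hg := (hasSum_nat_add_iff' (f := fun n : ℕ => (n : ℝ) * (r ^ 2) ^ n) 1).2
    (hasSum_coe_mul_geometric_of_norm_lt_one hr2)
  simp only [Finset.range_one, Finset.sum_singleton, Nat.cast_zero, zero_mul, sub_zero] at hg
  have hg2 := hg.mul_left ((1 - ‖a 0‖ ^ 2) ^ 2)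
  have hle (n : ℕ) : ((n : ℝ) + 1) * ‖a (n + 1)‖ ^ 2 * r ^ (2 * (n + 1)) ≤
      (1 - ‖a 0‖ ^ 2) ^ 2 * (((n + 1 : ℕ) : ℝ) * (r ^ 2) ^ (n + 1)) := by
    have h1 : ‖a (n + 1)‖ ^ 2 ≤ (1 - ‖a 0‖ ^ 2) ^ 2 :=
      pow_le_pow_left₀ (norm_nonneg _) (h.norm_coeff_succ_le n) 2
    have h3 : 0 ≤ ((n : ℝ) + 1) * (r ^ 2) ^ (n + 1) := by positivity
    have h4 := mul_le_mul_of_nonneg_right h1 h3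
    rw [pow_mul, Nat.cast_succ]
    linarith
  have hs : Summable fun n : ℕ => ((n : ℝ) + 1) * ‖a (n + 1)‖ ^ 2 * r ^ (2 * (n + 1)) :=
    Summable.of_nonneg_of_le (fun n => by positivity) hle hg2.summable
  rw [← hg2.tsum_eq, SrOverPi]
  exact hs.tsum_le_tsum hle hg2.summable

end InClassB

open ComplexConjugate

theorem norm_one_sub_conj_mul_sq_sub (b w : ℂ) :
    ‖1 - conj b * w‖ ^ 2 - ‖w - b‖ ^ 2 = (1 - ‖b‖ ^ 2) * (1 - ‖w‖ ^ 2) := by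
  simp only [Complex.sq_norm, Complex.normSq_apply, Complex.sub_re, Complex.sub_im, Complex.mul_re,
    Complex.mul_im, Complex.conj_re, Complex.conj_im, Complex.one_re, Complex.one_im]
  ring

theorem one_sub_conj_mul_ne_zero {b w : ℂ} (hb : ‖b‖ < 1) (hw : ‖w‖ ≤ 1) :
    1 - conj b * w ≠ 0 := by
  intro h0
  have h1 : ‖conj b * w‖ = 1 := by rw [← sub_eq_zero.1 h0, norm_one]
  rw [norm_mul, RCLike.norm_conj] at h1
  nlinarith [norm_nonneg b, norm_nonneg w]

theorem differentiableAt_moebius {b w : ℂ} (hb : ‖b‖ < 1) (hw : ‖w‖ ≤ 1) :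
    DifferentiableAt ℂ (fun w => (w - b) / (1 - conj b * w)) w :=
  (by fun_prop : DifferentiableAt ℂ (fun w => w - b) w).div (by fun_prop)
    (one_sub_conj_mul_ne_zero hb hw)

theorem norm_moebius_le_one {b w : ℂ} (hb : ‖b‖ < 1) (hw : ‖w‖ ≤ 1) :
    ‖(w - b) / (1 - conj b * w)‖ ≤ 1 := by
  rw [norm_div]
  refine div_le_one_of_le₀ ?_ (norm_nonneg _)
  refine le_of_sq_le_sq ?_ (norm_nonneg _)
  have := norm_one_sub_conj_mul_sq_sub b w
  have h2 : 0 ≤ (1 - ‖b‖ ^ 2) * (1 - ‖w‖ ^ 2) :=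
    mul_nonneg (by nlinarith [norm_nonneg b]) (by nlinarith [norm_nonneg w])
  linarith

theorem norm_moebius_lt_one {b w : ℂ} (hb : ‖b‖ < 1) (hw : ‖w‖ < 1) :
    ‖(w - b) / (1 - conj b * w)‖ < 1 := by
  rw [norm_div, div_lt_one (norm_pos_iff.2 (one_sub_conj_mul_ne_zero hb hw.le))]
  refine lt_of_pow_lt_pow_left₀ 2 (norm_nonneg _) ?_
  have := norm_one_sub_conj_mul_sq_sub b w
  have h2 : 0 < (1 - ‖b‖ ^ 2) * (1 - ‖w‖ ^ 2) :=
    mul_pos (by nlinarith [norm_nonneg b]) (by nlinarith [norm_nonneg w])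
  linarith

theorem norm_deriv_zero_le {g : ℂ → ℂ} (hd : DifferentiableOn ℂ g (Metric.ball 0 1))
    (hb : ∀ z : ℂ, ‖z‖ < 1 → ‖g z‖ ≤ 1) : ‖deriv g 0‖ ≤ 1 - ‖g 0‖ ^ 2 := by
  have hB : InClassB g fun n => (n.factorial : ℂ)⁻¹ * iteratedDeriv n g 0 := by
    refine ⟨fun z hz => ?_, hb⟩
    have := Complex.hasSum_taylorSeries_on_ball hd (z := z) (by simpa using hz)
    refine this.congr_fun ?_
    intro n
    simp only [sub_zero, smul_eq_mul]
    ring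
  simpa using hB.norm_coeff_succ_le 0

namespace InClassB

variable {f : ℂ → ℂ} {a : ℕ → ℂ}

theorem norm_deriv_mul_le (h : InClassB f a) {z : ℂ} (hz : ‖z‖ < 1) :
    ‖deriv f z‖ * (1 - ‖z‖ ^ 2) ≤ 1 - ‖f z‖ ^ 2 := by
  have hz' : ‖-z‖ < 1 := by rwa [norm_neg]
  set φ : ℂ → ℂ := fun w => (w - -z) / (1 - conj (-z) * w) with hφ
  have hφ0 : φ 0 = z := by simp [hφ]
  have hφd : HasDerivAt φ (1 - ‖z‖ ^ 2) 0 := by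
    have h1 : HasDerivAt (fun w : ℂ => w - -z) 1 0 := (hasDerivAt_id 0).sub_const _
    have h2 : HasDerivAt (fun w : ℂ => 1 - conj (-z) * w) (-(conj (-z) * 1)) 0 :=
      ((hasDerivAt_id 0).const_mul _).const_sub 1
    have h3 := h1.div h2 (by simp)
    refine h3.congr_deriv ?_
    rw [← Complex.mul_conj']
    simp
  have hmem (w : ℂ) (hw : ‖w‖ < 1) : ‖φ w‖ < 1 := norm_moebius_lt_one hz' hw
  have hdiff : DifferentiableOn ℂ (f ∘ φ) (Metric.ball 0 1) := by
    refine h.differentiableOn.comp (fun w hw => ?_) fun w hw => ?_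
    · have hw1 : ‖w‖ < 1 := by simpa using hw
      exact (differentiableAt_moebius hz' hw1.le).differentiableWithinAt
    · simpa using hmem w (by simpa using hw)
  have hfd : DifferentiableAt ℂ f (φ 0) := by
    rw [hφ0]
    exact h.differentiableOn.differentiableAt (Metric.isOpen_ball.mem_nhds (by simpa using hz))
  have hchain := (hfd.hasDerivAt.comp 0 hφd).deriv
  have hle := norm_deriv_zero_le hdiff fun w hw => h.2 _ (hmem w hw)
  rw [hchain, hφ0, Function.comp_apply, hφ0, norm_mul] at hle
  have hn : ‖(1 - (‖z‖ : ℂ) ^ 2)‖ = 1 - ‖z‖ ^ 2 := by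
    have : (1 - (‖z‖ : ℂ) ^ 2) = ((1 - ‖z‖ ^ 2 : ℝ) : ℂ) := by push_cast; rfl
    rw [this, Complex.norm_real, Real.norm_of_nonneg (by nlinarith [norm_nonneg z])]
  rwa [hn] at hle

theorem norm_mul_le (h : InClassB f a) {z : ℂ} (hz : ‖z‖ < 1) :
    ‖f z‖ * (1 + ‖a 0‖ * ‖z‖) ≤ ‖a 0‖ + ‖z‖ := by
  have hf := h.2 z hz
  have ha := h.norm_coeff_zero_le
  rcases ha.lt_or_eq with ha | ha
  · have hF : DifferentiableOn ℂ (fun w => (f w - a 0) / (1 - conj (a 0) * f w))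
        (Metric.ball 0 1) := by
      intro w hw
      have hw1 : ‖w‖ < 1 := by simpa using hw
      exact (differentiableAt_moebius ha (h.2 w hw1)).comp_differentiableWithinAt w
        (h.differentiableOn w hw)
    have hS := Complex.norm_le_norm_of_mapsTo_ball hF
      (fun w hw => by
        simpa using norm_moebius_le_one ha (h.2 w (by simpa using hw)))
      (by simp [h.coeff_zero]) hz
    rw [norm_div, div_le_iff₀ (norm_pos_iff.2 (one_sub_conj_mul_ne_zero ha hf))] at hS
    have hid := norm_one_sub_conj_mul_sq_sub (a 0) (f z)
    have hS2 := pow_le_pow_left₀ (norm_nonneg _) hS 2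
    have hlow : 1 - ‖a 0‖ * ‖f z‖ ≤ ‖1 - conj (a 0) * f z‖ := by
      have := norm_sub_norm_le 1 (conj (a 0) * f z)
      rwa [norm_one, norm_mul, RCLike.norm_conj] at this
    have ha0 := norm_nonneg (a 0)
    have hf0 := norm_nonneg (f z)
    have hz0 := norm_nonneg z
    have haf : ‖a 0‖ * ‖f z‖ ≤ 1 := mul_le_one₀ ha.le hf0 hf
    have hlow2 := pow_le_pow_left₀ (by linarith) hlow 2
    have hz2 : 0 ≤ 1 - ‖z‖ ^ 2 := by nlinarith
    have h1 : (‖f z‖ - ‖a 0‖) ^ 2 ≤ (‖z‖ * (1 - ‖a 0‖ * ‖f z‖)) ^ 2 := by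
      nlinarith [mul_le_mul_of_nonneg_right hlow2 hz2]
    have h2 := (abs_le.1 (abs_le_of_sq_le_sq h1 (mul_nonneg hz0 (by linarith)))).2
    linarith
  · rw [ha]
    nlinarith [norm_nonneg z]

end InClassB

theorem one_sub_extremal_eq {A R : ℝ} (hR : 2 * R ^ 2 + 3 * R = 1) (hR1 : 1 - R ≠ 0)
    (hA : 1 + A * R ≠ 0) :
    1 - ((A + R) / (1 + A * R) + R * ((1 - A ^ 2) / (1 + A * R) ^ 2) +
      (1 - A ^ 2) * (R ^ 2 / (1 - R))) =
      (1 - A) ^ 2 * (R ^ 2 * (3 + (1 - R) * A + R ^ 2 * A ^ 2) / ((1 + A * R) ^ 2 * (1 - R))) := by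
  field_simp
  linear_combination (-(1 - A) * (1 + A ^ 2 * R ^ 2)) * hR

theorem extremal_add_le_one {A R s : ℝ} (hR : 2 * R ^ 2 + 3 * R = 1) (hR0 : 0 < R)
    (hR1 : R ≤ 3 / 10) (hA0 : 0 ≤ A) (hA1 : A ≤ 1)
    (hs : s = (1 - A ^ 2) ^ 2 * (R ^ 2 / (1 - R ^ 2) ^ 2)) :
    s < 1 ∧ (A + R) / (1 + A * R) + R * ((1 - A ^ 2) / (1 + A * R) ^ 2) +
      (1 - A ^ 2) * (R ^ 2 / (1 - R)) +
        (4 - R + R ^ 2) * (1 - R) / 4 * (s / (1 - s)) ≤ 1 := by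
  have h1R : 0 < 1 - R := by linarith
  have hR2 : R ^ 2 ≤ 9 / 100 := by nlinarith
  have hAR : 0 < 1 + A * R := by positivity
  set K := R ^ 2 / (1 - R ^ 2) ^ 2 with hK
  have hK0 : 0 ≤ K := by positivity
  have hK1 : K ≤ 1 / 8 := by
    rw [hK, div_le_iff₀ (by nlinarith)]
    nlinarith
  have hs4 : (1 + A) ^ 2 ≤ 4 * (1 - s) := by
    have h1 : (1 - A) * (1 + A) ^ 2 ≤ 4 := by nlinarith
    have h2 : (1 - A) * ((1 - A) * (1 + A) ^ 2) ≤ (1 - A) * 4 := by gcongr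
    have h3 : K * ((1 - A) * ((1 - A) * (1 + A) ^ 2)) ≤ 1 / 8 * ((1 - A) * 4) := by
      gcongr
    rw [hs]
    nlinarith
  have hs1 : 0 < 1 - s := by nlinarith
  refine ⟨by linarith, ?_⟩
  have hS : s / (1 - s) ≤ (1 - A) ^ 2 * (4 * K) := by
    rw [div_le_iff₀ hs1]
    have := mul_le_mul_of_nonneg_left hs4 (mul_nonneg (sq_nonneg (1 - A)) hK0)
    calc s = (1 - A) ^ 2 * K * (1 + A) ^ 2 := by rw [hs]; ring
      _ ≤ _ := by linarith
  have hlam : 0 ≤ (4 - R + R ^ 2) * (1 - R) / 4 := by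
    have : 0 ≤ 4 - R + R ^ 2 := by nlinarith
    positivity
  have h1 := mul_le_mul_of_nonneg_left hS hlam
  have h2 : (4 - R + R ^ 2) * (1 - R) / 4 * (4 * K) ≤
      R ^ 2 * (3 + (1 - R) * A + R ^ 2 * A ^ 2) / ((1 + A * R) ^ 2 * (1 - R)) := by
    have e : (4 - R + R ^ 2) * (1 - R) / 4 * (4 * K) =
        R ^ 2 * (4 - R + R ^ 2) / ((1 + R) ^ 2 * (1 - R)) := by
      have : 1 - R ^ 2 ≠ 0 := by nlinarith
      rw [hK, show 1 - R ^ 2 = (1 - R) * (1 + R) by ring]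
      field_simp
    rw [e, div_le_div_iff₀ (by positivity) (by positivity)]
    have h3 : 0 ≤ (1 - A) * (4 * R + 3 * R ^ 2 * (1 - R) * A) :=
      mul_nonneg (by linarith) (by positivity)
    have h4 : (4 - R + R ^ 2) * (1 + A * R) ^ 2 ≤
        (3 + (1 - R) * A + R ^ 2 * A ^ 2) * (1 + R) ^ 2 := by
      linear_combination h3 + (A - 1) * hR
    have h5 := mul_le_mul_of_nonneg_left h4 (show 0 ≤ R ^ 2 * (1 - R) by positivity)
    linarith
  have h3 := mul_le_mul_of_nonneg_left h2 (sq_nonneg (1 - A))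
  have h4 := one_sub_extremal_eq hR h1R.ne' hAR.ne'
  linarith

theorem InClassB.gexpr2_le_one {f : ℂ → ℂ} {a : ℕ → ℂ} (h : InClassB f a) {R : ℝ}
    (hR : 2 * R ^ 2 + 3 * R = 1) (hR0 : 0 < R) (hR1 : R ≤ 3 / 10) {z : ℂ} (hz : ‖z‖ ≤ R) :
    Gexpr2 f a z ‖z‖ ((4 - R + R ^ 2) * (1 - R) / 4) ≤ 1 := by
  set r := ‖z‖ with hr
  have hr0 : 0 ≤ r := norm_nonneg z
  have hr1 : r < 1 := by linarith
  set A := ‖a 0‖ with hA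
  have hA0 : 0 ≤ A := norm_nonneg _
  have hA1 : A ≤ 1 := h.norm_coeff_zero_le
  have hA2 : 0 ≤ 1 - A ^ 2 := by nlinarith
  obtain ⟨hs1, hmain⟩ := extremal_add_le_one hR hR0 hR1 hA0 hA1 rfl
  set s := (1 - A ^ 2) ^ 2 * (R ^ 2 / (1 - R ^ 2) ^ 2) with hs
  have hAr : 0 < 1 + A * r := by positivity
  have hr2 : 0 < 1 - r ^ 2 := by nlinarith
  have hR2 : 0 < 1 - R ^ 2 := by nlinarith
  -- the terms involving the value and the derivative of the function
  have hF : ‖f z‖ ≤ (A + r) / (1 + A * r) := (le_div_iff₀ hAr).2 (h.norm_mul_le hr1)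
  have hD : ‖deriv f z‖ ≤ (1 - ‖f z‖ ^ 2) / (1 - r ^ 2) :=
    (le_div_iff₀ hr2).2 (h.norm_deriv_mul_le hr1)
  have hF1 : ‖f z‖ ≤ 1 := h.2 z hr1
  have hG1 : (A + r) / (1 + A * r) ≤ 1 := by
    rw [div_le_one hAr]
    nlinarith
  have hFD : ‖f z‖ + ‖deriv f z‖ * r ≤
      (A + r) / (1 + A * r) + r * ((1 - A ^ 2) / (1 + A * r) ^ 2) := by
    have e : (1 - A ^ 2) / (1 + A * r) ^ 2 = (1 - ((A + r) / (1 + A * r)) ^ 2) / (1 - r ^ 2) := by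
      field_simp
      ring
    rw [e]
    set G := (A + r) / (1 + A * r)
    have h1 : ‖deriv f z‖ * r ≤ r * ((1 - ‖f z‖ ^ 2) / (1 - r ^ 2)) := by
      rw [mul_comm]
      gcongr
    have h2 : r * ((1 - ‖f z‖ ^ 2) / (1 - r ^ 2)) - r * ((1 - G ^ 2) / (1 - r ^ 2)) =
        r / (1 - r ^ 2) * ((G - ‖f z‖) * (G + ‖f z‖)) := by
      ring
    have h3 : r / (1 - r ^ 2) ≤ 1 / 2 := by
      rw [div_le_div_iff₀ hr2 (by norm_num)]
      nlinarith
    have h4 : 0 ≤ (G - ‖f z‖) * (G + ‖f z‖) :=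
      mul_nonneg (by linarith) (by linarith [norm_nonneg (f z)])
    have h5 := mul_le_mul_of_nonneg_right h3 h4
    have h6 : (G - ‖f z‖) * (G + ‖f z‖) ≤ (G - ‖f z‖) * 2 := by
      gcongr
      linarith
    linarith
  have hm1 : (A + r) / (1 + A * r) ≤ (A + R) / (1 + A * R) := by
    rw [div_le_div_iff₀ hAr (by positivity)]
    have := mul_nonneg (sub_nonneg.2 hz) hA2
    linarith
  have hm2 : r * ((1 - A ^ 2) / (1 + A * r) ^ 2) ≤ R * ((1 - A ^ 2) / (1 + A * R) ^ 2) := by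
    rw [← mul_div_assoc, ← mul_div_assoc, div_le_div_iff₀ (by positivity) (by positivity)]
    have h1 : 0 ≤ 1 - A ^ 2 * (R * r) := by
      have : R * r ≤ 1 := by nlinarith
      nlinarith [sq_nonneg A]
    have := mul_nonneg hA2 (mul_nonneg (sub_nonneg.2 hz) h1)
    linarith
  have hm3 : (1 - A ^ 2) * (r ^ 2 / (1 - r)) ≤ (1 - A ^ 2) * (R ^ 2 / (1 - R)) := by
    have : 0 < 1 - R := by linarith
    gcongr
  have hB := h.tsum_add_tsum_le hr0 hr1
  have hS0 : 0 ≤ SrOverPi a r := InClassB.srOverPi_nonneg hr0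
  have hSs : SrOverPi a r ≤ s := by
    refine (h.srOverPi_le hr0 hr1).trans ?_
    rw [hs]
    gcongr
  have hS : SrOverPi a r / (1 - SrOverPi a r) ≤ s / (1 - s) := by
    have : 0 < 1 - s := by linarith
    gcongr
  have hlam : 0 ≤ (4 - R + R ^ 2) * (1 - R) / 4 :=
    div_nonneg (mul_nonneg (by linarith [sq_nonneg R]) (by linarith)) (by norm_num)
  have hl := mul_le_mul_of_nonneg_left hS hlam
  unfold Gexpr2
  rw [add_assoc (‖f z‖ + ‖deriv f z‖ * r)]
  exact (add_le_add (add_le_add (hFD.trans (add_le_add hm1 hm2)) (hB.trans hm3)) hl).trans hmain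

/-- The Taylor coefficients of the disk automorphism `z ↦ (z + α) / (1 + α z)`. -/
noncomputable def moebiusCoeff (α : ℝ) : ℕ → ℂ
  | 0 => α
  | n + 1 => (1 - α ^ 2) * (-α) ^ n

section Moebius

variable {α : ℝ}

theorem norm_moebiusCoeff_succ (h0 : 0 ≤ α) (h1 : α < 1) (n : ℕ) :
    ‖moebiusCoeff α (n + 1)‖ = (1 - α ^ 2) * α ^ n := by
  have h2 : 0 ≤ 1 - α ^ 2 := by nlinarith
  have h3 : (1 - (α : ℂ) ^ 2) = ((1 - α ^ 2 : ℝ) : ℂ) := by push_cast; rfl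
  rw [moebiusCoeff, norm_mul, norm_pow, norm_neg, h3, Complex.norm_real, Complex.norm_real,
    Real.norm_of_nonneg h0, Real.norm_of_nonneg h2]

theorem one_add_mul_ne_zero (h0 : 0 ≤ α) (h1 : α < 1) {z : ℂ} (hz : ‖z‖ < 1) :
    1 + (α : ℂ) * z ≠ 0 := by
  intro h
  have h2 : ‖(α : ℂ) * z‖ = 1 := by
    rw [eq_neg_of_add_eq_zero_right h, norm_neg, norm_one]
  rw [norm_mul, Complex.norm_real, Real.norm_of_nonneg h0] at h2
  nlinarith [norm_nonneg z]

theorem inClassB_moebius (h0 : 0 ≤ α) (h1 : α < 1) :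
    InClassB (fun z => (z + α) / (1 + α * z)) (moebiusCoeff α) := by
  refine ⟨fun z hz => ?_, fun z hz => ?_⟩
  · have hne := one_add_mul_ne_zero h0 h1 hz
    have hlt : ‖-(α : ℂ) * z‖ < 1 := by
      rw [norm_mul, norm_neg, Complex.norm_real, Real.norm_of_nonneg h0]
      nlinarith [norm_nonneg z]
    have hg := (hasSum_geometric_of_norm_lt_one hlt).mul_left ((1 - (α : ℂ) ^ 2) * z)
    refine (hasSum_nat_add_iff' (f := fun n => moebiusCoeff α n * z ^ n) 1).1 ?_
    have hterm (n : ℕ) : moebiusCoeff α (n + 1) * z ^ (n + 1) =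
        (1 - (α : ℂ) ^ 2) * z * (-(α : ℂ) * z) ^ n := by
      simp only [moebiusCoeff]
      ring
    have hsum : (z + α) / (1 + α * z) - ∑ n ∈ Finset.range 1, moebiusCoeff α n * z ^ n =
        (1 - (α : ℂ) ^ 2) * z * (1 - -(α : ℂ) * z)⁻¹ := by
      rw [Finset.sum_range_one, moebiusCoeff, neg_mul, sub_neg_eq_add, ← div_eq_mul_inv,
        eq_div_iff hne, sub_mul, div_mul_cancel₀ _ hne]
      ring
    simpa only [hterm, hsum] using hg
  · have hb : ‖-(α : ℂ)‖ < 1 := by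
      rwa [norm_neg, Complex.norm_real, Real.norm_of_nonneg h0]
    have := norm_moebius_le_one hb hz.le
    simpa using this

theorem gexpr2_moebius (h0 : 0 ≤ α) (h1 : α < 1) {R : ℝ} (hR0 : 0 ≤ R) (hR1 : R < 1) (lam : ℝ) :
    Gexpr2 (fun z => (z + α) / (1 + α * z)) (moebiusCoeff α) R R lam =
      (α + R) / (1 + α * R) + R * ((1 - α ^ 2) / (1 + α * R) ^ 2) +
      (1 - α ^ 2) * (R ^ 2 / (1 - R)) +
      lam * ((1 - α) ^ 2 * ((1 + α) ^ 2 * R ^ 2 / ((1 - R ^ 2) * (1 - α ^ 4 * R ^ 2)))) := by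
  have hα2 : 0 ≤ 1 - α ^ 2 := by nlinarith
  have hR : ‖(R : ℂ)‖ < 1 := by rwa [Complex.norm_real, Real.norm_of_nonneg hR0]
  have hne := one_add_mul_ne_zero h0 h1 hR
  have hαR : α * R < 1 := by nlinarith
  have hαR0 : 0 ≤ α * R := by positivity
  have hf : ‖((R : ℂ) + α) / (1 + α * R)‖ = (α + R) / (1 + α * R) := by
    have : ((R : ℂ) + α) / (1 + α * R) = (((α + R) / (1 + α * R) : ℝ) : ℂ) := by
      push_cast
      ring
    rw [this, Complex.norm_real, Real.norm_of_nonneg (by positivity)]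
  have hd : ‖deriv (fun z : ℂ => (z + α) / (1 + α * z)) R‖ = (1 - α ^ 2) / (1 + α * R) ^ 2 := by
    have hder : HasDerivAt (fun z : ℂ => (z + α) / (1 + α * z))
        ((1 * (1 + α * R) - (R + α) * (α * 1)) / (1 + α * R) ^ 2) (R : ℂ) :=
      ((hasDerivAt_id _).add_const _).div (((hasDerivAt_id _).const_mul _).const_add _) hne
    have : (1 * (1 + (α : ℂ) * R) - (R + α) * (α * 1)) / (1 + α * R) ^ 2 =
        (((1 - α ^ 2) / (1 + α * R) ^ 2 : ℝ) : ℂ) := by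
      push_cast
      ring
    rw [hder.deriv, this, Complex.norm_real, Real.norm_of_nonneg (by positivity)]
  have hB : ∑' n, ‖moebiusCoeff α (n + 2)‖ * R ^ (n + 2) =
      (1 - α ^ 2) * α * R ^ 2 * (1 - α * R)⁻¹ := by
    rw [← tsum_geometric_of_lt_one hαR0 hαR, ← tsum_mul_left]
    refine tsum_congr fun n => ?_
    rw [norm_moebiusCoeff_succ h0 h1 (n + 1)]
    ring
  have hαR2 : (α * R) ^ 2 < 1 := pow_lt_one₀ hαR0 hαR (by norm_num)
  have hA : ∑' n, ‖moebiusCoeff α (n + 1)‖ ^ 2 * R ^ (2 * (n + 1)) =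
      (1 - α ^ 2) ^ 2 * R ^ 2 * (1 - (α * R) ^ 2)⁻¹ := by
    rw [← tsum_geometric_of_lt_one (sq_nonneg _) hαR2, ← tsum_mul_left]
    refine tsum_congr fun n => ?_
    rw [norm_moebiusCoeff_succ h0 h1 n]
    ring
  have hS : SrOverPi (moebiusCoeff α) R =
      (1 - α ^ 2) ^ 2 * R ^ 2 * (1 / (1 - (α * R) ^ 2) ^ 2) := by
    have hg := tsum_choose_mul_geometric_of_norm_lt_one (𝕜 := ℝ) 1 (r := (α * R) ^ 2)
      (by rwa [Real.norm_of_nonneg (sq_nonneg _)])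
    rw [← hg, ← tsum_mul_left, SrOverPi]
    refine tsum_congr fun n => ?_
    rw [norm_moebiusCoeff_succ h0 h1 n, Nat.choose_one_right]
    push_cast
    ring
  have h0' : ‖moebiusCoeff α 0‖ = α := by
    rw [moebiusCoeff, Complex.norm_real, Real.norm_of_nonneg h0]
  have e1 : (1 - α ^ 2) * α * R ^ 2 * (1 - α * R)⁻¹ +
      (1 / (1 + α) + R / (1 - R)) * ((1 - α ^ 2) ^ 2 * R ^ 2 * (1 - (α * R) ^ 2)⁻¹) =
      (1 - α ^ 2) * (R ^ 2 / (1 - R)) := by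
    have d1 : 1 - α * R ≠ 0 := by linarith
    have d2 : 1 + α * R ≠ 0 := by linarith
    have d3 : 1 - R ≠ 0 := by linarith
    have d4 : 1 + α ≠ 0 := by linarith
    rw [show 1 - (α * R) ^ 2 = (1 - α * R) * (1 + α * R) by ring]
    field_simp
    ring
  have e2 : (1 - α ^ 2) ^ 2 * R ^ 2 * (1 / (1 - (α * R) ^ 2) ^ 2) /
      (1 - (1 - α ^ 2) ^ 2 * R ^ 2 * (1 / (1 - (α * R) ^ 2) ^ 2)) =
      (1 - α) ^ 2 * ((1 + α) ^ 2 * R ^ 2 / ((1 - R ^ 2) * (1 - α ^ 4 * R ^ 2))) := by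
    have d1 : (1 - (α * R) ^ 2) ^ 2 ≠ 0 := by
      have : 1 - (α * R) ^ 2 ≠ 0 := by linarith
      positivity
    have d2 : 1 - R ^ 2 ≠ 0 := by nlinarith
    have d3 : 1 - α ^ 4 * R ^ 2 ≠ 0 := by
      have : α ^ 4 * R ^ 2 ≤ (α * R) ^ 2 := by
        have : α ^ 2 * (α * R) ^ 2 ≤ 1 * (α * R) ^ 2 := by gcongr; linarith
        linarith
      linarith
    have e3 : 1 - (1 - α ^ 2) ^ 2 * R ^ 2 * (1 / (1 - (α * R) ^ 2) ^ 2) =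
        (1 - R ^ 2) * (1 - α ^ 4 * R ^ 2) * (1 / (1 - (α * R) ^ 2) ^ 2) := by
      rw [mul_one_div, mul_one_div, eq_div_iff d1, sub_mul, div_mul_cancel₀ _ d1]
      ring
    rw [e3, mul_div_mul_right _ _ (one_div_ne_zero d1)]
    ring
  rw [Gexpr2, hB, hA, hS, h0', hf, hd, e2, ← e1]
  ring

end Moebius

theorem exists_one_lt_gexpr2_moebius {R lam : ℝ} (hR : 2 * R ^ 2 + 3 * R = 1) (hR0 : 0 < R)
    (hR1 : R ≤ 3 / 10) (hlam : (4 - R + R ^ 2) * (1 - R) / 4 < lam) :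
    ∃ α : ℝ, 0 ≤ α ∧ α < 1 ∧
      1 < Gexpr2 (fun z => (z + α) / (1 + α * z)) (moebiusCoeff α) R R lam := by
  have h1R : 0 < 1 - R := by linarith
  have hR2 : 0 < 1 - R ^ 2 := by nlinarith
  have hlim : ContinuousAt (fun α : ℝ =>
      R ^ 2 * (3 + (1 - R) * α + R ^ 2 * α ^ 2) / ((1 + α * R) ^ 2 * (1 - R)) -
        lam * ((1 + α) ^ 2 * R ^ 2 / ((1 - R ^ 2) * (1 - α ^ 4 * R ^ 2)))) 1 := by
    have d1 : (1 + 1 * R) ^ 2 * (1 - R) ≠ 0 := by positivity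
    have d2 : (1 - R ^ 2) * (1 - 1 ^ 4 * R ^ 2) ≠ 0 := by
      rw [one_pow, one_mul]
      positivity
    fun_prop (disch := assumption)
  have hneg : R ^ 2 * (3 + (1 - R) * 1 + R ^ 2 * 1 ^ 2) / ((1 + 1 * R) ^ 2 * (1 - R)) -
      lam * ((1 + 1) ^ 2 * R ^ 2 / ((1 - R ^ 2) * (1 - 1 ^ 4 * R ^ 2))) < 0 := by
    have e : R ^ 2 * (3 + (1 - R) * 1 + R ^ 2 * 1 ^ 2) / ((1 + 1 * R) ^ 2 * (1 - R)) =
        (4 - R + R ^ 2) * (1 - R) / 4 *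
          ((1 + 1) ^ 2 * R ^ 2 / ((1 - R ^ 2) * (1 - 1 ^ 4 * R ^ 2))) := by
      rw [one_pow, one_mul, show 1 - R ^ 2 = (1 - R) * (1 + R) by ring]
      field_simp
      ring
    rw [e, ← sub_mul]
    refine mul_neg_of_neg_of_pos (by linarith) ?_
    rw [one_pow, one_mul]
    positivity
  have hev := (hlim.eventually_lt continuousAt_const hneg).filter_mono
    (nhdsWithin_le_nhds (s := Set.Iio 1))
  have hIoo : ∀ᶠ α : ℝ in 𝓝[<] 1, α ∈ Set.Ioo (0 : ℝ) 1 :=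
    Ioo_mem_nhdsLT one_pos
  obtain ⟨α, hα, hα0, hα1⟩ := (hev.and hIoo).exists
  refine ⟨α, hα0.le, hα1, ?_⟩
  have hid := one_sub_extremal_eq hR h1R.ne' (show 1 + α * R ≠ 0 by positivity)
  rw [gexpr2_moebius hα0.le hα1 hR0.le (by linarith)]
  have := mul_neg_of_pos_of_neg (pow_pos (sub_pos.2 hα1) 2) hα
  linarith

theorem stmt_4 :
    (∀ f a, InClassB f a → ∀ z : ℂ, ‖z‖ ≤ (Real.sqrt 17 - 3) / 4 →
      Gexpr2 f a z ‖z‖ ((221 - 43 * Real.sqrt 17) / 64) ≤ 1) ∧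
    (∀ lam' : ℝ, (221 - 43 * Real.sqrt 17) / 64 < lam' →
      ∃ f a, InClassB f a ∧ ∃ z : ℂ, ‖z‖ = (Real.sqrt 17 - 3) / 4 ∧
        1 < Gexpr2 f a z ((Real.sqrt 17 - 3) / 4) lam') := by
  have h17 : Real.sqrt 17 ^ 2 = 17 := Real.sq_sqrt (by norm_num)
  have h41 : 4.1 < Real.sqrt 17 := Real.lt_sqrt_of_sq_lt (by norm_num)
  have h42 : Real.sqrt 17 < 4.2 := (Real.sqrt_lt' (by norm_num)).2 (by norm_num)
  set R := (Real.sqrt 17 - 3) / 4 with hRdef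
  have hsqrt : Real.sqrt 17 = 4 * R + 3 := by rw [hRdef]; ring
  rw [hsqrt] at h17 h41 h42
  have hR : 2 * R ^ 2 + 3 * R = 1 := by linarith
  have hR0 : 0 < R := by linarith
  have hR1 : R ≤ 3 / 10 := by linarith
  have hlam : (221 - 43 * Real.sqrt 17) / 64 = (4 - R + R ^ 2) * (1 - R) / 4 := by
    rw [hsqrt]
    linear_combination (R / 8 - 7 / 16) * hR
  rw [hlam]
  refine ⟨fun f a h z hz => h.gexpr2_le_one hR hR0 hR1 hz, fun lam' hlam' => ?_⟩
  obtain ⟨α, h0, h1, hα⟩ := exists_one_lt_gexpr2_moebius hR hR0 hR1 hlam'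
  refine ⟨_, _, inClassB_moebius h0 h1, R, ?_, hα⟩
  rw [Complex.norm_real, Real.norm_of_nonneg hR0.le]
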